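/- arXiv:1912.13138 — 4 statements merged into one kernel-verified Lean document; each statement's English description precedes it below -/
import Mathlib

section
/- Pointwise invariance of the dual CCM condition under matched uncertainty (algebraic core of Lemma 1): Let n, m, k be natural numbers and λ a real number. Let W be a real symmetric n×n matrix, F and Ẇ₀ real n×n matrices, and for each i = 1,…,m let Jᵢ be a real n×n matrix, bᵢ, gᵢ ∈ ℝⁿ vectors, sᵢ ∈ ℝ a scalar, and Dᵢ a real n×n matrix satisfying the Killing-field condition Dᵢ = W Jᵢᵀ + Jᵢ W. Let B⊥ be a real n×k matrix whose columns are orthogonal to every bᵢ, i.e. bᵢᵀ B⊥ = 0 for all i. Define A := F + Σᵢ sᵢ Jᵢ + Σᵢ bᵢ gᵢᵀ and Ẇ := Ẇ₀ + Σᵢ sᵢ Dᵢ. Then B⊥ᵀ (W Aᵀ + A W − Ẇ + 2λ W) B⊥ = B⊥ᵀ (W Fᵀ + F W − Ẇ₀ + 2λ W) B⊥. In particular, the dual control contraction metric condition B⊥ᵀ(W Fᵀ + F W − Ẇ₀ + 2λ W)B⊥ ⪯ 0 for the nominal dynamics implies the same condition for the perturbed dynamics with matched uncertainty. -/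
open Matrix BigOperators

/-- A matrix annihilated on the left by every `b i` is annihilated by the transpose of
`∑ i, b i (g i)ᵀ`. -/
theorem transpose_sum_vecMulVec_mul_eq_zero {R ι α β γ : Type*} [CommSemiring R] [Fintype ι]
    [Fintype α] (b : ι → α → R) (g : ι → β → R) (M : Matrix α γ R)
    (h : ∀ i, b i ᵥ* M = 0) : (∑ i, vecMulVec (b i) (g i))ᵀ * M = 0 := by
  rw [transpose_sum, Matrix.sum_mul]
  refine Finset.sum_eq_zero fun i _ => ?_
  rw [transpose_vecMulVec, vecMulVec_mul, h]
  ext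
  simp [vecMulVec_apply]

/-- Pointwise invariance of the dual CCM condition under matched uncertainty
(algebraic core of Lemma 1). -/
theorem dual_ccm_invariance_matched {n m k : ℕ} (lam : ℝ)
    (W F W0dot : Matrix (Fin n) (Fin n) ℝ) (hWsymm : W.IsSymm)
    (J D : Fin m → Matrix (Fin n) (Fin n) ℝ)
    (b g : Fin m → (Fin n → ℝ)) (s : Fin m → ℝ)
    (hKilling : ∀ i, D i = W * (J i)ᵀ + J i * W)
    (Bperp : Matrix (Fin n) (Fin k) ℝ)
    (hOrth : ∀ i, (b i) ᵥ* Bperp = 0)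
    (A Wdot : Matrix (Fin n) (Fin n) ℝ)
    (hA : A = F + ∑ i, s i • J i + ∑ i, vecMulVec (b i) (g i))
    (hWdot : Wdot = W0dot + ∑ i, s i • D i) :
    Bperpᵀ * (W * Aᵀ + A * W - Wdot + (2 * lam) • W) * Bperp
      = Bperpᵀ * (W * Fᵀ + F * W - W0dot + (2 * lam) • W) * Bperp ∧
    ((-(Bperpᵀ * (W * Fᵀ + F * W - W0dot + (2 * lam) • W) * Bperp)).PosSemidef →
      (-(Bperpᵀ * (W * Aᵀ + A * W - Wdot + (2 * lam) • W) * Bperp)).PosSemidef) := by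
  have hG := transpose_sum_vecMulVec_mul_eq_zero b g Bperp hOrth
  have hG' : Bperpᵀ * ∑ i, vecMulVec (b i) (g i) = 0 := by
    simpa using congrArg transpose hG
  have hD : ∑ i, s i • D i = W * (∑ i, s i • J i)ᵀ + (∑ i, s i • J i) * W := by
    simp [hKilling, transpose_sum, Matrix.mul_sum, Matrix.sum_mul, Finset.sum_add_distrib]
  rw [hD] at hWdot
  generalize ∑ i, vecMulVec (b i) (g i) = G at hA hG hG'
  generalize ∑ i, s i • J i = S at hA hWdot
  have hEq : Bperpᵀ * (W * Aᵀ + A * W - Wdot + (2 * lam) • W) * Bperp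
      = Bperpᵀ * (W * Fᵀ + F * W - W0dot + (2 * lam) • W) * Bperp := by
    have hsplit : W * Aᵀ + A * W - Wdot + (2 * lam) • W
        = (W * Fᵀ + F * W - W0dot + (2 * lam) • W) + (W * Gᵀ + G * W) := by
      rw [hA, hWdot]
      simp only [transpose_add, Matrix.mul_add, Matrix.add_mul]
      abel
    have hzero : Bperpᵀ * (W * Gᵀ + G * W) * Bperp = 0 := by
      rw [Matrix.mul_add, Matrix.add_mul, ← Matrix.mul_assoc Bperpᵀ G W, hG',
        Matrix.mul_assoc, Matrix.mul_assoc W, hG]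
      simp
    rw [hsplit, Matrix.mul_add, Matrix.add_mul, hzero, add_zero]
  exact ⟨hEq, fun h => hEq ▸ h⟩
end

section
/- Lyapunov identity and boundedness for the adaptive virtual system (key step of Theorem 2): Let λ > 0, let Γ be a symmetric positive definite real p×p matrix, let φ : [0,∞) → ℝ^p be continuous, and let y₁ : [0,∞) → ℝ and y₂ : [0,∞) → ℝ^p be differentiable functions satisfying y₁′(t) = −2λ y₁(t) + 2⟨φ(t), y₂(t)⟩ and y₂′(t) = −y₁(t) Γ φ(t) for all t ≥ 0. Then V(t) := (1/2) y₁(t)² + ⟨y₂(t), Γ⁻¹ y₂(t)⟩ is differentiable with V′(t) = −2λ y₁(t)² ≤ 0 for all t ≥ 0; consequently V is nonincreasing and both y₁ and y₂ are bounded on [0,∞). -/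
open scoped InnerProductSpace

namespace Matrix.PosDef

variable {n : Type*} [Fintype n] [DecidableEq n] {M : Matrix n n ℝ}

theorem toEuclideanLin_inv_apply_apply (hM : M.PosDef) (v : EuclideanSpace ℝ n) :
    toEuclideanLin M⁻¹ (toEuclideanLin M v) = v := by
  have hdet : IsUnit M.det := (isUnit_iff_isUnit_det M).mp hM.isUnit
  simp [toLpLin_apply, mulVec_mulVec, nonsing_inv_mul M hdet]

theorem inner_toEuclideanLin_nonneg (hM : M.PosDef) (v : EuclideanSpace ℝ n) :
    0 ≤ ⟪v, toEuclideanLin M v⟫_ℝ :=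
  (isPositive_toEuclideanLin_iff.mpr hM.posSemidef).re_inner_nonneg_right v

theorem inner_toEuclideanLin_comm (hM : M.PosDef) (v w : EuclideanSpace ℝ n) :
    ⟪toEuclideanLin M v, w⟫_ℝ = ⟪v, toEuclideanLin M w⟫_ℝ :=
  isSymmetric_toEuclideanLin_iff.mpr hM.isHermitian v w

theorem inner_toEuclideanLin_toEuclideanLin_inv (hM : M.PosDef) (v w : EuclideanSpace ℝ n) :
    ⟪toEuclideanLin M v, toEuclideanLin M⁻¹ w⟫_ℝ = ⟪v, w⟫_ℝ := by
  rw [← hM.inv.inner_toEuclideanLin_comm, hM.toEuclideanLin_inv_apply_apply]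

/-- The quadratic form of the inverse of a positive definite matrix is coercive. -/
theorem exists_norm_sq_le_mul_inner_inv (hM : M.PosDef) :
    ∃ K > 0, ∀ v : EuclideanSpace ℝ n, ‖v‖ ^ 2 ≤ K * ⟪v, toEuclideanLin M⁻¹ v⟫_ℝ := by
  set L := LinearMap.toContinuousLinearMap (toEuclideanLin M)
  refine ⟨‖L‖ + 1, by positivity, fun v => ?_⟩
  have hK : 0 < ‖L‖ + 1 := by positivity
  have hbound : ⟪v, toEuclideanLin M v⟫_ℝ ≤ (‖L‖ + 1) * ‖v‖ ^ 2 := by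
    have h₁ : ⟪v, L v⟫_ℝ ≤ ‖v‖ * ‖L v‖ := real_inner_le_norm _ _
    have h₂ : ‖v‖ * ‖L v‖ ≤ ‖v‖ * (‖L‖ * ‖v‖) := by gcongr; exact L.le_opNorm v
    have h₃ : ⟪v, L v⟫_ℝ = ⟪v, toEuclideanLin M v⟫_ℝ := rfl
    nlinarith [sq_nonneg ‖v‖]
  have hnonneg := hM.inv.inner_toEuclideanLin_nonneg ((‖L‖ + 1) • v - toEuclideanLin M v)
  simp only [map_sub, map_smul, inner_sub_left, inner_sub_right, inner_smul_left,
    inner_smul_right, hM.toEuclideanLin_inv_apply_apply,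
    hM.inner_toEuclideanLin_toEuclideanLin_inv, real_inner_self_eq_norm_sq, conj_trivial,
    hM.inner_toEuclideanLin_comm] at hnonneg
  refine le_of_mul_le_mul_left ?_ hK
  nlinarith

end Matrix.PosDef

/-- Lyapunov identity and boundedness for the adaptive virtual system
(key step of Theorem 2). -/
theorem virtual_system_lyapunov_identity {p : ℕ} (lam : ℝ) (hlam : 0 < lam)
    (Γ : Matrix (Fin p) (Fin p) ℝ) (hΓ : Γ.PosDef)
    (φ : ℝ → EuclideanSpace ℝ (Fin p)) (hφ : ContinuousOn φ (Set.Ici 0))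
    (y₁ : ℝ → ℝ) (y₂ : ℝ → EuclideanSpace ℝ (Fin p))
    (hy₁ : ∀ t ≥ (0 : ℝ),
      HasDerivWithinAt y₁ (-2 * lam * y₁ t + 2 * ⟪φ t, y₂ t⟫_ℝ) (Set.Ici 0) t)
    (hy₂ : ∀ t ≥ (0 : ℝ),
      HasDerivWithinAt y₂ (-(y₁ t) • Matrix.toEuclideanLin Γ (φ t))
        (Set.Ici 0) t) :
    (∀ t ≥ (0 : ℝ),
      HasDerivWithinAt
        (fun t => (1 / 2) * y₁ t ^ 2 + ⟪y₂ t, Matrix.toEuclideanLin Γ⁻¹ (y₂ t)⟫_ℝ)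
        (-2 * lam * y₁ t ^ 2) (Set.Ici 0) t) ∧
    AntitoneOn
      (fun t => (1 / 2) * y₁ t ^ 2 + ⟪y₂ t, Matrix.toEuclideanLin Γ⁻¹ (y₂ t)⟫_ℝ)
      (Set.Ici 0) ∧
    (∃ C : ℝ, ∀ t ≥ (0 : ℝ), |y₁ t| ≤ C ∧ ‖y₂ t‖ ≤ C) := by
  have hderiv : ∀ t ≥ (0 : ℝ),
      HasDerivWithinAt
        (fun t => (1 / 2) * y₁ t ^ 2 + ⟪y₂ t, Matrix.toEuclideanLin Γ⁻¹ (y₂ t)⟫_ℝ)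
        (-2 * lam * y₁ t ^ 2) (Set.Ici 0) t := by
    intro t ht
    have hinv := (LinearMap.toContinuousLinearMap
      (Matrix.toEuclideanLin Γ⁻¹)).hasFDerivAt.comp_hasDerivWithinAt t (hy₂ t ht)
    refine ((((hy₁ t ht).pow 2).const_mul (1 / 2)).add
      ((hy₂ t ht).inner ℝ hinv)).congr_deriv ?_
    simp only [LinearMap.coe_toContinuousLinearMap', Function.comp_apply, map_smul,
      inner_smul_left, inner_smul_right, hΓ.toEuclideanLin_inv_apply_apply,
      hΓ.inner_toEuclideanLin_toEuclideanLin_inv, conj_trivial, real_inner_comm (φ t) (y₂ t)]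
    ring
  have hanti : AntitoneOn
      (fun t => (1 / 2) * y₁ t ^ 2 + ⟪y₂ t, Matrix.toEuclideanLin Γ⁻¹ (y₂ t)⟫_ℝ)
      (Set.Ici 0) := by
    refine antitoneOn_of_hasDerivWithinAt_nonpos (convex_Ici 0)
      (fun t ht => (hderiv t ht).continuousWithinAt)
      (fun t ht => (hderiv t (interior_subset ht)).mono interior_subset) fun t _ => ?_
    nlinarith [mul_nonneg hlam.le (sq_nonneg (y₁ t))]
  refine ⟨hderiv, hanti, ?_⟩
  obtain ⟨K, hK, hcoer⟩ := hΓ.exists_norm_sq_le_mul_inner_inv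
  set V₀ := (1 / 2) * y₁ 0 ^ 2 + ⟪y₂ 0, Matrix.toEuclideanLin Γ⁻¹ (y₂ 0)⟫_ℝ
  refine ⟨max √(2 * V₀) √(K * V₀), fun t ht => ?_⟩
  have hV : (1 / 2) * y₁ t ^ 2 + ⟪y₂ t, Matrix.toEuclideanLin Γ⁻¹ (y₂ t)⟫_ℝ ≤ V₀ :=
    hanti Set.self_mem_Ici ht ht
  have hnonneg := hΓ.inv.inner_toEuclideanLin_nonneg (y₂ t)
  constructor
  · exact le_max_of_le_left (Real.abs_le_sqrt (by linarith))
  · refine le_max_of_le_right (Real.le_sqrt_of_sq_le ((hcoer _).trans ?_))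
    gcongr
    linarith [sq_nonneg (y₁ t)]
end

section
/- Convergence of the virtual system (Barbalat step of Theorem 2): Let λ > 0, let Γ be a symmetric positive definite real p×p matrix, let φ : [0,∞) → ℝ^p be continuous and bounded, and let y₁ : [0,∞) → ℝ and y₂ : [0,∞) → ℝ^p be differentiable functions satisfying y₁′(t) = −2λ y₁(t) + 2⟨φ(t), y₂(t)⟩ and y₂′(t) = −y₁(t) Γ φ(t) for all t ≥ 0. Then y₁(t) → 0 as t → ∞. -/
open scoped InnerProductSpace
open Filter

theorem image_sub_le_mul_sub_of_hasDerivWithinAt_Ici {f f' : ℝ → ℝ} {a b c C : ℝ}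
    (hf : ∀ t ≥ c, HasDerivWithinAt f (f' t) (Set.Ici c) t) (hca : c ≤ a) (hab : a ≤ b)
    (hC : ∀ t ∈ Set.Icc a b, f' t ≤ C) : f b - f a ≤ C * (b - a) := by
  have hd : ∀ t ∈ Set.Ioo a b, HasDerivAt f (f' t) t := fun t ht =>
    (hf t (hca.trans ht.1.le)).hasDerivAt (Ici_mem_nhds (hca.trans_lt ht.1))
  refine (convex_Icc a b).image_sub_le_mul_sub_of_deriv_le (f := f) ?_ ?_ ?_
    a (Set.left_mem_Icc.2 hab) b (Set.right_mem_Icc.2 hab) hab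
  · exact fun t ht => (hf t (hca.trans ht.1)).continuousWithinAt.mono
      fun s hs => hca.trans hs.1
  · rw [interior_Icc]
    exact fun t ht => (hd t ht).differentiableAt.differentiableWithinAt
  · rw [interior_Icc]
    exact fun t ht => (hd t ht).deriv ▸ hC t (Set.Ioo_subset_Icc_self ht)

/-- A form of Barbalat's lemma: a function with bounded derivative whose square is dominated by
the dissipation rate of a function bounded below tends to zero. -/
theorem tendsto_zero_of_hasDerivWithinAt_le_neg_sq {f f' V V' : ℝ → ℝ} {c K m : ℝ} (hc : 0 < c)
    (hf : ∀ t ≥ (0 : ℝ), HasDerivWithinAt f (f' t) (Set.Ici 0) t)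
    (hK : ∀ t ≥ (0 : ℝ), |f' t| ≤ K)
    (hV : ∀ t ≥ (0 : ℝ), HasDerivWithinAt V (V' t) (Set.Ici 0) t)
    (hV' : ∀ t ≥ (0 : ℝ), V' t ≤ -c * f t ^ 2) (hm : ∀ t ≥ (0 : ℝ), m ≤ V t) :
    Tendsto f atTop (nhds 0) := by
  have hK0 : 0 ≤ K := (abs_nonneg _).trans (hK 0 le_rfl)
  have hanti : Antitone fun t => V (max t 0) := by
    intro s t hst
    have h := image_sub_le_mul_sub_of_hasDerivWithinAt_Ici hV (le_max_right s 0)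
      (max_le_max_right 0 hst) (C := 0) fun r hr => by
        have hr0 : 0 ≤ r := (le_max_right s 0).trans hr.1
        nlinarith [hV' r hr0, mul_nonneg hc.le (sq_nonneg (f r))]
    simp only
    linarith
  have hlim := tendsto_atTop_ciInf hanti
    ⟨m, by rintro _ ⟨t, rfl⟩; exact hm _ (le_max_right t 0)⟩
  rw [Metric.tendsto_atTop]
  intro ε hε
  set d := ε / (2 * (K + 1)) with hd
  have hd0 : 0 < d := by positivity
  have hKd : K * d ≤ ε / 2 := by
    have : (K + 1) * d = ε / 2 := by rw [hd]; field_simp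
    nlinarith
  have hdiff := hlim.sub (hlim.comp (tendsto_atTop_add_const_right atTop d tendsto_id))
  rw [sub_self] at hdiff
  obtain ⟨N, hN⟩ := eventually_atTop.1
    (hdiff.eventually_lt_const (show 0 < c * (ε / 2) ^ 2 * d by positivity))
  refine ⟨max N 0, fun t ht => ?_⟩
  have ht0 : 0 ≤ t := (le_max_right N 0).trans ht
  rw [Real.dist_eq, sub_zero]
  by_contra! hft
  have hdrop := hN t ((le_max_left N 0).trans ht)
  simp only [Function.comp_apply, id_eq, max_eq_left ht0,
    max_eq_left (add_nonneg ht0 hd0.le)] at hdrop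
  have hlarge : ∀ s ∈ Set.Icc t (t + d), V' s ≤ -c * (ε / 2) ^ 2 := by
    intro s hs
    have hs0 : 0 ≤ s := ht0.trans hs.1
    have hlip := (convex_Ici (0 : ℝ)).norm_image_sub_le_of_norm_hasDerivWithin_le hf hK
      (Set.mem_Ici.2 ht0) (Set.mem_Ici.2 hs0)
    rw [Real.norm_eq_abs, Real.norm_eq_abs, abs_of_nonneg (sub_nonneg.2 hs.1)] at hlip
    have hle : K * (s - t) ≤ K * d := by gcongr; linarith [hs.2]
    have hfs : ε / 2 ≤ |f s| := by
      have := abs_sub_abs_le_abs_sub (f t) (f s)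
      rw [abs_sub_comm] at this
      linarith
    have hsq : (ε / 2) ^ 2 ≤ f s ^ 2 := by
      rw [← sq_abs (f s)]
      gcongr
    nlinarith [hV' s hs0]
  have h := image_sub_le_mul_sub_of_hasDerivWithinAt_Ici hV ht0 (by linarith) hlarge
  rw [add_sub_cancel_left] at h
  linarith

/-- Convergence of the adaptive error system with identity gain. -/
theorem tendsto_zero_of_skew_coupled {E : Type*} [NormedAddCommGroup E] [InnerProductSpace ℝ E]
    {lam C : ℝ} (hlam : 0 < lam) {ψ z : ℝ → E} {y : ℝ → ℝ} (hψ : ∀ t ≥ (0 : ℝ), ‖ψ t‖ ≤ C)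
    (hy : ∀ t ≥ (0 : ℝ),
      HasDerivWithinAt y (-2 * lam * y t + 2 * ⟪ψ t, z t⟫_ℝ) (Set.Ici 0) t)
    (hz : ∀ t ≥ (0 : ℝ), HasDerivWithinAt z (-(y t) • ψ t) (Set.Ici 0) t) :
    Tendsto y atTop (nhds 0) := by
  have hC0 : 0 ≤ C := (norm_nonneg _).trans (hψ 0 le_rfl)
  set V : ℝ → ℝ := fun t => y t ^ 2 + 2 * ‖z t‖ ^ 2
  have hV : ∀ t ≥ (0 : ℝ), HasDerivWithinAt V (-(4 * lam) * y t ^ 2) (Set.Ici 0) t := by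
    intro t ht
    refine (((hy t ht).pow 2).add ((hz t ht).norm_sq.const_mul 2)).congr_deriv ?_
    rw [inner_smul_right, real_inner_comm]
    push_cast
    ring
  have hVle : ∀ t ≥ (0 : ℝ), V t ≤ V 0 := by
    intro t ht
    have h := image_sub_le_mul_sub_of_hasDerivWithinAt_Ici hV le_rfl ht (C := 0)
      fun s _ => by nlinarith [mul_nonneg hlam.le (sq_nonneg (y s))]
    linarith
  have hyle : ∀ t ≥ (0 : ℝ), |y t| ≤ √(V 0) := fun t ht =>
    Real.abs_le_sqrt (by nlinarith [hVle t ht, sq_nonneg ‖z t‖])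
  have hzle : ∀ t ≥ (0 : ℝ), ‖z t‖ ≤ √(V 0) := fun t ht =>
    Real.le_sqrt_of_sq_le (by nlinarith [hVle t ht, sq_nonneg ‖z t‖, sq_nonneg (y t)])
  refine tendsto_zero_of_hasDerivWithinAt_le_neg_sq (c := 4 * lam) (m := 0)
    (K := 2 * lam * √(V 0) + 2 * (C * √(V 0))) (by positivity) hy (fun t ht => ?_) hV
    (fun t _ => le_rfl) (fun t _ => by positivity)
  have hinner : |⟪ψ t, z t⟫_ℝ| ≤ C * √(V 0) :=
    (abs_real_inner_le_norm _ _).trans (mul_le_mul (hψ t ht) (hzle t ht) (norm_nonneg _) hC0)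
  refine (abs_add_le _ _).trans (add_le_add ?_ ?_)
  · rw [abs_mul, abs_mul, abs_neg, abs_two, abs_of_pos hlam]
    gcongr
    exact hyle t ht
  · rw [abs_mul, abs_two]
    gcongr

open scoped Matrix.Norms.L2Operator MatrixOrder ComplexOrder in
theorem Matrix.PosDef.exists_isUnit_eq_star_mul_self {n 𝕜 : Type*} [Fintype n] [DecidableEq n]
    [RCLike 𝕜] {A : Matrix n n 𝕜} (hA : A.PosDef) :
    ∃ B : Matrix n n 𝕜, IsUnit B ∧ A = star B * B :=
  CStarAlgebra.isStrictlyPositive_iff_eq_star_mul_self.mp hA.isStrictlyPositive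

/-- Convergence of the virtual system (Barbalat step of Theorem 2). -/
theorem virtual_system_y1_tendsto_zero {p : ℕ} (lam : ℝ) (hlam : 0 < lam)
    (Γ : Matrix (Fin p) (Fin p) ℝ) (hΓ : Γ.PosDef)
    (φ : ℝ → EuclideanSpace ℝ (Fin p)) (hφ : ContinuousOn φ (Set.Ici 0))
    (hφbdd : ∃ C : ℝ, ∀ t ≥ (0 : ℝ), ‖φ t‖ ≤ C)
    (y₁ : ℝ → ℝ) (y₂ : ℝ → EuclideanSpace ℝ (Fin p))
    (hy₁ : ∀ t ≥ (0 : ℝ),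
      HasDerivWithinAt y₁ (-2 * lam * y₁ t + 2 * ⟪φ t, y₂ t⟫_ℝ) (Set.Ici 0) t)
    (hy₂ : ∀ t ≥ (0 : ℝ),
      HasDerivWithinAt y₂ (-(y₁ t) • Matrix.toEuclideanLin Γ (φ t))
        (Set.Ici 0) t) :
    Tendsto y₁ atTop (nhds 0) := by
  obtain ⟨C, hC⟩ := hφbdd
  obtain ⟨B, hB, rfl⟩ := hΓ.exists_isUnit_eq_star_mul_self
  set T := Matrix.toEuclideanCLM (n := Fin p) (𝕜 := ℝ)
  obtain ⟨U, hU⟩ := (hB.map T).star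
  have hadj : star (T B) = ContinuousLinearMap.adjoint (T B) := rfl
  have hUT : ∀ x, U⁻¹.val (star (T B) x) = x := fun x => by
    rw [← hU, ← mul_apply_eq_comp, Units.inv_mul, one_apply_eq_self]
  have hTU : ∀ x, star (T B) (U⁻¹.val x) = x := fun x => by
    rw [← hU, ← mul_apply_eq_comp, Units.mul_inv, one_apply_eq_self]
  have hΓapply : ∀ x, Matrix.toEuclideanLin (star B * B) x = star (T B) (T B x) := fun x => by
    rw [← Matrix.coe_toEuclideanCLM_eq_toEuclideanLin, map_mul, map_star]
    rfl
  refine tendsto_zero_of_skew_coupled hlam (ψ := fun t => T B (φ t))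
    (z := fun t => U⁻¹.val (y₂ t)) (C := ‖T B‖ * C) (fun t ht => ?_)
    (fun t ht => ?_) (fun t ht => ?_)
  · exact (T B).le_opNorm_of_le (hC t ht)
  · rw [← ContinuousLinearMap.adjoint_inner_right, ← hadj, hTU]
    exact hy₁ t ht
  · have h := U⁻¹.val.hasFDerivAt.comp_hasDerivWithinAt t (hy₂ t ht)
    rwa [hΓapply, map_smul, hUT] at h
end

section
/- Comparison and asymptotic convergence of the energy (conclusion of Theorem 2 in abstract form): Let λ > 0, let Γ be a symmetric positive definite real p×p matrix, let φ : [0,∞) → ℝ^p be continuous and bounded, and let y₁ : [0,∞) → ℝ and y₂ : [0,∞) → ℝ^p be differentiable functions satisfying y₁′(t) = −2λ y₁(t) + 2⟨φ(t), y₂(t)⟩ and y₂′(t) = −y₁(t) Γ φ(t) for all t ≥ 0. Suppose moreover that E : [0,∞) → ℝ is differentiable with E(t) ≥ 0 for all t, E(0) ≤ y₁(0), and E′(t) ≤ −2λ E(t) + 2⟨φ(t), y₂(t)⟩ for all t ≥ 0. Then 0 ≤ E(t) ≤ y₁(t) for all t ≥ 0, and E(t) → 0 as t → ∞. -/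
open scoped InnerProductSpace
open Filter

/-- If `f 0 ≥ 0` and `f' ≥ -k f` on `[0, ∞)`, then `f ≥ 0` there. -/
theorem nonneg_of_hasDerivWithinAt_ge_neg_mul {k : ℝ} {f f' : ℝ → ℝ}
    (hf : ∀ t ≥ (0 : ℝ), HasDerivWithinAt f (f' t) (Set.Ici 0) t)
    (hf' : ∀ t ≥ (0 : ℝ), -k * f t ≤ f' t) (h0 : 0 ≤ f 0) :
    ∀ t ≥ (0 : ℝ), 0 ≤ f t := by
  intro t ht
  have hd : ∀ s ≥ (0 : ℝ), HasDerivWithinAt (fun s => Real.exp (k * s) * f s)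
      (Real.exp (k * s) * (k * f s + f' s)) (Set.Ici 0) s := by
    intro s hs
    have he : HasDerivWithinAt (fun s => Real.exp (k * s)) (Real.exp (k * s) * (k * 1))
        (Set.Ici 0) s := (((hasDerivAt_id s).const_mul k).exp).hasDerivWithinAt
    exact (he.mul (hf s hs)).congr_deriv (by ring)
  have hmono : MonotoneOn (fun s => Real.exp (k * s) * f s) (Set.Ici 0) := by
    refine monotoneOn_of_hasDerivWithinAt_nonneg (convex_Ici 0)
      (fun s hs => (hd s hs).continuousWithinAt)
      (fun s hs => (hd s (interior_subset hs)).mono interior_subset) fun s hs => ?_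
    have := hf' s (interior_subset hs)
    exact mul_nonneg (Real.exp_pos _).le (by linarith)
  have h := hmono (Set.self_mem_Ici) ht ht
  simp only [mul_zero, Real.exp_zero, one_mul] at h
  exact (mul_nonneg_iff_of_pos_left (Real.exp_pos _)).1 (h0.trans h)

/-- A function that is antitone and bounded below on `[0, ∞)` converges at infinity. -/
theorem AntitoneOn.exists_tendsto_atTop_of_bddBelow {f : ℝ → ℝ} {m : ℝ}
    (hf : AntitoneOn f (Set.Ici 0)) (hm : ∀ t ≥ (0 : ℝ), m ≤ f t) :
    ∃ l, Tendsto f atTop (nhds l) := by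
  have hanti : Antitone fun t => f (max t 0) := fun s t hst =>
    hf (le_max_right s 0) (le_max_right t 0) (max_le_max_right 0 hst)
  have hbdd : BddBelow (Set.range fun t => f (max t 0)) :=
    ⟨m, by rintro _ ⟨t, rfl⟩; exact hm _ (le_max_right t 0)⟩
  refine ⟨_, (tendsto_atTop_ciInf hanti hbdd).congr' ?_⟩
  filter_upwards [eventually_ge_atTop 0] with t ht
  rw [max_eq_left ht]

/-- A one-sided Barbalat lemma: if `V` is bounded below with `V' = -c y²`, and `y ≥ 0` has
derivative bounded above, then `y` tends to zero. -/
theorem tendsto_zero_of_hasDerivWithinAt_neg_mul_sq {c K m : ℝ} (hc : 0 < c)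
    {V y y' : ℝ → ℝ}
    (hV : ∀ t ≥ (0 : ℝ), HasDerivWithinAt V (-c * y t ^ 2) (Set.Ici 0) t)
    (hVm : ∀ t ≥ (0 : ℝ), m ≤ V t)
    (hy : ∀ t ≥ (0 : ℝ), HasDerivWithinAt y (y' t) (Set.Ici 0) t)
    (hy' : ∀ t ≥ (0 : ℝ), y' t ≤ K) (hy0 : ∀ t ≥ (0 : ℝ), 0 ≤ y t) :
    Tendsto y atTop (nhds 0) := by
  have hVanti : AntitoneOn V (Set.Ici 0) := by
    refine antitoneOn_of_hasDerivWithinAt_nonpos (convex_Ici 0)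
      (fun s hs => (hV s hs).continuousWithinAt)
      (fun s hs => (hV s (interior_subset hs)).mono interior_subset) fun s _ => ?_
    nlinarith [sq_nonneg (y s)]
  obtain ⟨l, hl⟩ := hVanti.exists_tendsto_atTop_of_bddBelow hVm
  set b := 3 * |K| / c with hb
  have hb0 : 0 ≤ b := by positivity
  have hWd : ∀ t ≥ (0 : ℝ), HasDerivWithinAt (fun t => y t ^ 3 + b * V t)
      (3 * y t ^ 2 * (y' t - |K|)) (Set.Ici 0) t := by
    intro t ht
    refine (((hy t ht).pow 3).add ((hV t ht).const_mul b)).congr_deriv ?_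
    rw [hb]
    field_simp
    push_cast
    ring
  have hWanti : AntitoneOn (fun t => y t ^ 3 + b * V t) (Set.Ici 0) := by
    refine antitoneOn_of_hasDerivWithinAt_nonpos (convex_Ici 0)
      (fun s hs => (hWd s hs).continuousWithinAt)
      (fun s hs => (hWd s (interior_subset hs)).mono interior_subset) fun s hs => ?_
    have h1 := hy' s (interior_subset hs)
    exact mul_nonpos_of_nonneg_of_nonpos (by positivity) (by linarith [le_abs_self K])
  obtain ⟨w, hw⟩ := hWanti.exists_tendsto_atTop_of_bddBelow (m := b * m) fun t ht => by
    have h1 := pow_nonneg (hy0 t ht) 3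
    have h2 := mul_le_mul_of_nonneg_left (hVm t ht) hb0
    linarith
  have hcube : Tendsto (fun t => y t ^ 3) atTop (nhds (w - b * l)) :=
    (hw.sub (hl.const_mul b)).congr fun t => by ring
  have hmvt : ∀ t : ℝ, ∃ s, t ≤ s ∧ (0 ≤ t → -c * y s ^ 2 = V (t + 1) - V t) := by
    intro t
    by_cases ht : 0 ≤ t
    · obtain ⟨s, hs, hs'⟩ := exists_hasDerivAt_eq_slope V (fun t => -c * y t ^ 2)
        (lt_add_one t)
        (fun s hs => ((hV s (ht.trans hs.1)).continuousWithinAt).mono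
          fun r hr => ht.trans hr.1)
        (fun s hs => (hV s (ht.trans hs.1.le)).hasDerivAt (Ici_mem_nhds (ht.trans_lt hs.1)))
      exact ⟨s, hs.1.le, fun _ => by simpa using hs'⟩
    · exact ⟨t, le_rfl, fun h => absurd h ht⟩
  choose s hs hs' using hmvt
  have hs_top : Tendsto s atTop atTop := tendsto_atTop_mono hs tendsto_id
  have hdiff : Tendsto (fun t => V (t + 1) - V t) atTop (nhds 0) := by
    simpa using (hl.comp (tendsto_atTop_add_const_right atTop (1 : ℝ) tendsto_id)).sub hl
  have hsq : Tendsto (fun t => y (s t) ^ 2) atTop (nhds 0) := by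
    have h := hdiff.const_mul (-c⁻¹)
    rw [mul_zero] at h
    refine h.congr' ?_
    filter_upwards [eventually_ge_atTop 0] with t ht
    rw [← hs' t ht]
    field_simp
  have hys : Tendsto (fun t => y (s t)) atTop (nhds 0) := by
    have h := hsq.sqrt
    rw [Real.sqrt_zero] at h
    refine h.congr' ?_
    filter_upwards [eventually_ge_atTop 0] with t ht
    exact Real.sqrt_sq (hy0 _ (ht.trans (hs t)))
  have hlim : w - b * l = 0 := by
    have h := hys.pow 3
    rw [zero_pow three_ne_zero] at h
    exact tendsto_nhds_unique (hcube.comp hs_top) h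
  rw [hlim] at hcube
  have h := hcube.rpow_const (p := 1 / 3) (Or.inr (by norm_num))
  rw [Real.zero_rpow (by norm_num)] at h
  refine h.congr' ?_
  filter_upwards [eventually_ge_atTop 0] with t ht
  rw [← Real.rpow_natCast, ← Real.rpow_mul (hy0 t ht)]
  norm_num

/-- For the adaptive system `y₁' = -2λ y₁ + 2⟪φ, y₂⟫`, `y₂' = -y₁ G φ` with `H` a symmetric
nonnegative left inverse of `G`, the component `y₁` tends to zero once it is nonnegative. -/
theorem tendsto_zero_of_adaptive_system {F : Type*} [NormedAddCommGroup F]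
    [InnerProductSpace ℝ F] {lam C : ℝ} (hlam : 0 < lam) (G H : F →L[ℝ] F)
    (hHsymm : ∀ u v, ⟪H u, v⟫_ℝ = ⟪u, H v⟫_ℝ) (hHG : ∀ v, H (G v) = v)
    (hHnonneg : ∀ v, 0 ≤ ⟪v, H v⟫_ℝ) {φ : ℝ → F} (hφ : ∀ t ≥ (0 : ℝ), ‖φ t‖ ≤ C)
    {y₁ : ℝ → ℝ} {y₂ : ℝ → F}
    (hy₁ : ∀ t ≥ (0 : ℝ),
      HasDerivWithinAt y₁ (-2 * lam * y₁ t + 2 * ⟪φ t, y₂ t⟫_ℝ) (Set.Ici 0) t)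
    (hy₂ : ∀ t ≥ (0 : ℝ), HasDerivWithinAt y₂ (-(y₁ t) • G (φ t)) (Set.Ici 0) t)
    (hy₁nonneg : ∀ t ≥ (0 : ℝ), 0 ≤ y₁ t) :
    Tendsto y₁ atTop (nhds 0) := by
  set V : ℝ → ℝ := fun t => y₁ t ^ 2 + 2 * ⟪y₂ t, H (y₂ t)⟫_ℝ with hVdef
  have hV : ∀ t ≥ (0 : ℝ), HasDerivWithinAt V (-(4 * lam) * y₁ t ^ 2) (Set.Ici 0) t := by
    intro t ht
    have hH := H.hasFDerivAt.comp_hasDerivWithinAt t (hy₂ t ht)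
    refine (((hy₁ t ht).pow 2).add
      (((hy₂ t ht).inner ℝ hH).const_mul 2)).congr_deriv ?_
    simp only [Function.comp_apply, map_smul, hHG, inner_smul_left, inner_smul_right,
      ← hHsymm (G (φ t)), real_inner_comm (φ t) (y₂ t)]
    simp
    ring
  have hVanti : AntitoneOn V (Set.Ici 0) := by
    refine antitoneOn_of_hasDerivWithinAt_nonpos (convex_Ici 0)
      (fun s hs => (hV s hs).continuousWithinAt)
      (fun s hs => (hV s (interior_subset hs)).mono interior_subset) fun s _ => ?_
    nlinarith [sq_nonneg (y₁ s)]
  refine tendsto_zero_of_hasDerivWithinAt_neg_mul_sq (c := 4 * lam) (m := 0)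
    (K := V 0 + ‖G‖ * C ^ 2) (by positivity) hV
    (fun t _ => add_nonneg (sq_nonneg _) (mul_nonneg zero_le_two (hHnonneg _)))
    hy₁ (fun t ht => ?_) hy₁nonneg
  have hVt : V t ≤ V 0 := hVanti Set.self_mem_Ici ht ht
  have hq := hHnonneg (y₂ t)
  have hyoung := hHnonneg (y₂ t - G (φ t))
  have hcross : ⟪G (φ t), H (y₂ t)⟫_ℝ = ⟪φ t, y₂ t⟫_ℝ := by rw [← hHsymm, hHG]
  rw [map_sub, hHG, inner_sub_left, inner_sub_right, inner_sub_right, hcross,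
    real_inner_comm (φ t) (y₂ t)] at hyoung
  have hG : ⟪G (φ t), φ t⟫_ℝ ≤ ‖G‖ * C ^ 2 :=
    calc ⟪G (φ t), φ t⟫_ℝ ≤ ‖G (φ t)‖ * ‖φ t‖ := real_inner_le_norm _ _
      _ ≤ ‖G‖ * ‖φ t‖ * ‖φ t‖ := by gcongr; exact G.le_opNorm _
      _ = ‖G‖ * ‖φ t‖ ^ 2 := by ring
      _ ≤ ‖G‖ * C ^ 2 := by gcongr; exact hφ t ht
  have hly := mul_nonneg hlam.le (hy₁nonneg t ht)
  simp only [hVdef] at hVt ⊢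
  nlinarith [sq_nonneg (y₁ t)]

/-- Comparison and asymptotic convergence of the energy
(conclusion of Theorem 2 in abstract form). -/
theorem energy_comparison_tendsto_zero {p : ℕ} (lam : ℝ) (hlam : 0 < lam)
    (Γ : Matrix (Fin p) (Fin p) ℝ) (hΓ : Γ.PosDef)
    (φ : ℝ → EuclideanSpace ℝ (Fin p)) (hφ : ContinuousOn φ (Set.Ici 0))
    (hφbdd : ∃ C : ℝ, ∀ t ≥ (0 : ℝ), ‖φ t‖ ≤ C)
    (y₁ : ℝ → ℝ) (y₂ : ℝ → EuclideanSpace ℝ (Fin p))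
    (hy₁ : ∀ t ≥ (0 : ℝ),
      HasDerivWithinAt y₁ (-2 * lam * y₁ t + 2 * ⟪φ t, y₂ t⟫_ℝ) (Set.Ici 0) t)
    (hy₂ : ∀ t ≥ (0 : ℝ),
      HasDerivWithinAt y₂ (-(y₁ t) • Matrix.toEuclideanLin Γ (φ t))
        (Set.Ici 0) t)
    (E E' : ℝ → ℝ)
    (hE : ∀ t ≥ (0 : ℝ), HasDerivWithinAt E (E' t) (Set.Ici 0) t)
    (hEnonneg : ∀ t ≥ (0 : ℝ), 0 ≤ E t)
    (hE0 : E 0 ≤ y₁ 0)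
    (hE' : ∀ t ≥ (0 : ℝ), E' t ≤ -2 * lam * E t + 2 * ⟪φ t, y₂ t⟫_ℝ) :
    (∀ t ≥ (0 : ℝ), 0 ≤ E t ∧ E t ≤ y₁ t) ∧ Tendsto E atTop (nhds 0) := by
  have hle : ∀ t ≥ (0 : ℝ), E t ≤ y₁ t := by
    intro t ht
    refine sub_nonneg.1 (nonneg_of_hasDerivWithinAt_ge_neg_mul (k := 2 * lam)
      (f := fun t => y₁ t - E t) (fun s hs => (hy₁ s hs).sub (hE s hs)) (fun s hs => ?_)
      (sub_nonneg.2 hE0) t ht)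
    linarith [hE' s hs]
  refine ⟨fun t ht => ⟨hEnonneg t ht, hle t ht⟩, ?_⟩
  obtain ⟨C, hC⟩ := hφbdd
  have hdet : IsUnit Γ.det := hΓ.det_pos.ne'.isUnit
  have hlim : Tendsto y₁ atTop (nhds 0) := by
    refine tendsto_zero_of_adaptive_system hlam (Matrix.toEuclideanLin Γ).toContinuousLinearMap
      (Matrix.toEuclideanLin Γ⁻¹).toContinuousLinearMap (fun u v => ?_) (fun v => ?_)
      (fun v => ?_) hC hy₁ hy₂ (fun t ht => (hEnonneg t ht).trans (hle t ht))
    · exact Matrix.isSymmetric_toEuclideanLin_iff.2 hΓ.inv.isHermitian u v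
    · simp [Matrix.toLpLin_apply, Matrix.nonsing_inv_mul Γ hdet]
    · exact (Matrix.isPositive_toEuclideanLin_iff.2 hΓ.inv.posSemidef).inner_nonneg_right v
  refine tendsto_of_tendsto_of_tendsto_of_le_of_le' tendsto_const_nhds hlim ?_ ?_
  · filter_upwards [eventually_ge_atTop 0] with t ht using hEnonneg t ht
  · filter_upwards [eventually_ge_atTop 0] with t ht using hle t ht
end
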